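/- Let I be a monomial ideal of S and let u, v ∈ G(I) be monomials with gcd(u,v) = 1. Assume there is no monomial w ∈ G(I) with w ≠ u, w ≠ v, and supp(w) ⊆ supp(u) ∪ supp(v). Then for every integer s ≥ 1 and every monomial w' ∈ G(I^s) with w' ≠ v^s and w' | u v^s, one has lcm(v^s, w') = u v^s. -/

import Mathlib

open MvPolynomial

/-- The monomial ideal of `MvPolynomial (Fin n) K` generated by the monomials
whose exponent vectors lie in `A`. -/
noncomputable def mIdeal (K : Type) [Field K] {n : ℕ} (A : Set (Fin n →₀ ℕ)) :
    Ideal (MvPolynomial (Fin n) K) :=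
  Ideal.span ((fun a => monomial a (1 : K)) '' A)

/-- `G` is the (unique) minimal set of monomial generators of the monomial ideal `I`:
the monomials with exponent vectors in `G` generate `I`, and `G` is an antichain with
respect to divisibility of monomials (i.e. the pointwise order on exponent vectors). -/
def IsMinGen (K : Type) [Field K] {n : ℕ} (G : Finset (Fin n →₀ ℕ))
    (I : Ideal (MvPolynomial (Fin n) K)) : Prop :=
  I = mIdeal K (↑G : Set (Fin n →₀ ℕ)) ∧ ∀ a ∈ G, ∀ b ∈ G, a ≤ b → a = b

theorem monomial_mem_mIdeal_iff {K : Type} [Field K] {n : ℕ} (A : Set (Fin n →₀ ℕ))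
    (a : Fin n →₀ ℕ) : monomial a (1 : K) ∈ mIdeal K A ↔ ∃ b ∈ A, b ≤ a := by
  classical
  rw [mIdeal, mem_ideal_span_monomial_image]
  simp [support_monomial]

open scoped Pointwise in
theorem mIdeal_mul {K : Type} [Field K] {n : ℕ} (A B : Set (Fin n →₀ ℕ)) :
    mIdeal K A * mIdeal K B = mIdeal K (A + B) := by
  rw [mIdeal, mIdeal, mIdeal, Ideal.span_mul_span']
  congr 1
  rw [← Set.image2_mul, ← Set.image2_add, Set.image_image2, Set.image2_image_left,
    Set.image2_image_right]
  simp [monomial_mul]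

open scoped Pointwise in
theorem mIdeal_pow {K : Type} [Field K] {n : ℕ} (A : Set (Fin n →₀ ℕ)) (s : ℕ) :
    mIdeal K A ^ s = mIdeal K (s • A) := by
  induction s with
  | zero =>
    rw [pow_zero, zero_nsmul, eq_comm, Ideal.one_eq_top, Ideal.eq_top_iff_one]
    exact (monomial_mem_mIdeal_iff _ 0).2 ⟨0, Set.zero_mem_zero, le_rfl⟩
  | succ s ih => rw [pow_succ, ih, mIdeal_mul, succ_nsmul]

open scoped Pointwise in
/-- Every minimal monomial generator of `I ^ s` is a product of `s` minimal monomial generators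
of `I`. -/
theorem IsMinGen.mem_nsmul_of_pow {K : Type} [Field K] {n : ℕ}
    {I : Ideal (MvPolynomial (Fin n) K)} {G Gs : Finset (Fin n →₀ ℕ)} {s : ℕ}
    (hG : IsMinGen K G I) (hGs : IsMinGen K Gs (I ^ s)) {w : Fin n →₀ ℕ} (hw : w ∈ Gs) :
    w ∈ s • (G : Set (Fin n →₀ ℕ)) := by
  have heq : mIdeal K (Gs : Set (Fin n →₀ ℕ)) = mIdeal K (s • (G : Set (Fin n →₀ ℕ))) := by
    rw [← hGs.1, hG.1, mIdeal_pow]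
  have hmem := (monomial_mem_mIdeal_iff (K := K) (Gs : Set (Fin n →₀ ℕ)) w).2 ⟨w, hw, le_rfl⟩
  rw [heq, monomial_mem_mIdeal_iff] at hmem
  obtain ⟨g, hg, hgw⟩ := hmem
  have hmem := (monomial_mem_mIdeal_iff (K := K) (s • (G : Set (Fin n →₀ ℕ))) g).2 ⟨g, hg, le_rfl⟩
  rw [← heq, monomial_mem_mIdeal_iff] at hmem
  obtain ⟨h, hh, hhg⟩ := hmem
  obtain rfl := hGs.2 h hh w hw (hhg.trans hgw)
  exact le_antisymm hgw hhg ▸ hg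

open scoped Pointwise in
/-- If `u` and `v` are the only elements of `A` supported in `T`, then every sum of `s` elements
of `A` supported in `T` is a sum of copies of `u` and `v`. -/
theorem exists_eq_nsmul_add_nsmul_of_mem_nsmul {n : ℕ} {A : Set (Fin n →₀ ℕ)}
    {u v : Fin n →₀ ℕ} {T : Set (Fin n)}
    (hA : ∀ a ∈ A, (a.support : Set (Fin n)) ⊆ T → a = u ∨ a = v) {s : ℕ} {w : Fin n →₀ ℕ}
    (hw : w ∈ s • A) (hT : (w.support : Set (Fin n)) ⊆ T) :
    ∃ a b : ℕ, a + b = s ∧ w = a • u + b • v := by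
  induction s generalizing w with
  | zero =>
    rw [zero_nsmul, Set.mem_zero] at hw
    exact ⟨0, 0, rfl, by simp [hw]⟩
  | succ s ih =>
    rw [succ_nsmul] at hw
    obtain ⟨x, hx, y, hy, rfl⟩ := Set.mem_add.1 hw
    obtain ⟨a, b, rfl, rfl⟩ := ih hx fun i hi =>
      hT (Finset.mem_coe.2 (Finsupp.support_mono le_self_add hi))
    rcases hA y hy fun i hi =>
      hT (Finset.mem_coe.2 (Finsupp.support_mono le_add_self hi)) with rfl | rfl
    · exact ⟨a + 1, b, by omega, by rw [succ_nsmul]; abel⟩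
    · exact ⟨a, b + 1, by omega, by rw [succ_nsmul]; abel⟩

/-- Let `I` be a monomial ideal with minimal monomial generators `G`, and let
`u, v ∈ G(I)` with `gcd(u,v) = 1`.  If there is no `w ∈ G(I)` with `w ≠ u`, `w ≠ v` and
`supp w ⊆ supp u ∪ supp v`, then for every `s ≥ 1` and every `w' ∈ G(I^s)` with
`w' ≠ v^s` and `w' ∣ u v^s` one has `lcm(v^s, w') = u v^s`.  (On exponent vectors,
`v^s = s • v`, divisibility is `≤`, multiplication is `+` and lcm is `⊔`.) -/
theorem lcm_with_power_eq_of_no_support_witness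
    {K : Type} [Field K] {n : ℕ}
    (I : Ideal (MvPolynomial (Fin n) K)) (G : Finset (Fin n →₀ ℕ)) (hG : IsMinGen K G I)
    (u v : Fin n →₀ ℕ) (hu : u ∈ G) (hv : v ∈ G) (huv : u ⊓ v = 0)
    (hno : ¬ ∃ w ∈ G, w ≠ u ∧ w ≠ v ∧
      (w.support : Set (Fin n)) ⊆ (u.support : Set (Fin n)) ∪ (v.support : Set (Fin n)))
    (s : ℕ) (hs : 1 ≤ s)
    (Gs : Finset (Fin n →₀ ℕ)) (hGs : IsMinGen K Gs (I ^ s))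
    (w' : Fin n →₀ ℕ) (hw' : w' ∈ Gs) (hne : w' ≠ s • v) (hdvd : w' ≤ u + s • v) :
    (s • v) ⊔ w' = u + s • v := by
  have hT : (w'.support : Set (Fin n)) ⊆ (u.support : Set (Fin n)) ∪ (v.support : Set (Fin n)) := by
    intro i hi
    have hle := hdvd i
    simp only [Finset.mem_coe, Finsupp.mem_support_iff, Set.mem_union, Finsupp.add_apply,
      Finsupp.smul_apply, smul_eq_mul] at hi hle ⊢
    by_contra! hzero
    simp [hzero.1, hzero.2, hi] at hle
  obtain ⟨a, b, rfl, rfl⟩ := exists_eq_nsmul_add_nsmul_of_mem_nsmul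
    (fun w hw hsupp => by
      by_contra! hwne
      exact hno ⟨w, hw, hwne.1, hwne.2, hsupp⟩) (hG.mem_nsmul_of_pow hGs hw') hT
  have ha : 1 ≤ a := by
    rw [Nat.one_le_iff_ne_zero]
    rintro rfl
    simp at hne
  ext i
  have hle := hdvd i
  have hdisj := DFunLike.congr_fun huv i
  simp only [Finsupp.inf_apply, Finsupp.sup_apply, Finsupp.add_apply, Finsupp.smul_apply,
    smul_eq_mul, Finsupp.coe_zero, Pi.zero_apply] at hle hdisj ⊢
  rcases (by omega : u i = 0 ∨ v i = 0) with h | h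
  · simp [h, add_mul]
  · simp only [h, mul_zero, add_zero] at hle ⊢
    rw [Nat.zero_max]
    exact le_antisymm hle (Nat.le_mul_of_pos_left _ ha)
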